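/- For all real numbers a, b with 0 < a < b < 1 there exists κ > 0 such that every BMSC W (with any finite output alphabet) satisfying a ≤ I(W) ≤ b obeys I(W⁺) − I(W⁻) ≥ κ. -/

import Mathlib

open Finset

section Channels

variable {Y Y₁ Y₂ : Type*}

/-- A binary-input channel with finite output alphabet: nonnegative entries,
each row summing to one. -/
def IsChannel [Fintype Y] (W : ZMod 2 → Y → ℝ) : Prop :=
  (∀ x y, 0 ≤ W x y) ∧ ∀ x, ∑ y, W x y = 1

/-- A binary-input memoryless symmetric channel (BMSC): a channel admitting an
involution of the output alphabet exchanging the two conditional distributions. -/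
def IsBMSC [Fintype Y] (W : ZMod 2 → Y → ℝ) : Prop :=
  IsChannel W ∧ ∃ π : Y → Y, Function.Involutive π ∧ ∀ y, W 1 y = W 0 (π y)

/-- The Bhattacharyya parameter of a binary-input channel. -/
noncomputable def Zparam [Fintype Y] (W : ZMod 2 → Y → ℝ) : ℝ :=
  ∑ y, Real.sqrt (W 0 y * W 1 y)

/-- The symmetric capacity of a binary-input channel. -/
noncomputable def capacity [Fintype Y] (W : ZMod 2 → Y → ℝ) : ℝ :=
  ∑ x : ZMod 2, ∑ y, (1 / 2) * W x y *
    Real.logb 2 (W x y / ((1 / 2) * (W 0 y + W 1 y)))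

/-- The minus polar transform ⟨W₁,W₂⟩⁻. -/
noncomputable def polarMinus [Fintype Y₁] [Fintype Y₂] (W₁ : ZMod 2 → Y₁ → ℝ)
    (W₂ : ZMod 2 → Y₂ → ℝ) : ZMod 2 → Y₁ × Y₂ → ℝ :=
  fun u₁ y => (1 / 2) * ∑ u₂ : ZMod 2, W₁ (u₁ + u₂) y.1 * W₂ u₂ y.2

/-- The plus polar transform ⟨W₁,W₂⟩⁺, with output (y₁, y₂, u₁). -/
noncomputable def polarPlus [Fintype Y₁] [Fintype Y₂] (W₁ : ZMod 2 → Y₁ → ℝ)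
    (W₂ : ZMod 2 → Y₂ → ℝ) : ZMod 2 → Y₁ × Y₂ × ZMod 2 → ℝ :=
  fun u₂ y => (1 / 2) * W₁ (y.2.2 + u₂) y.1 * W₂ u₂ y.2.1

/-- The contribution to the symmetric capacity of an output letter whose two likelihoods
are `a` and `b`. -/
noncomputable def letterInfo (a b : ℝ) : ℝ :=
  (1 / 2) * a * Real.logb 2 (a / ((1 / 2) * (a + b))) +
    (1 / 2) * b * Real.logb 2 (b / ((1 / 2) * (a + b)))

theorem sum_zmod_two (f : ZMod 2 → ℝ) : ∑ x, f x = f 0 + f 1 :=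
  Fin.sum_univ_two f

theorem capacity_eq_sum_letterInfo [Fintype Y] (W : ZMod 2 → Y → ℝ) :
    capacity W = ∑ y, letterInfo (W 0 y) (W 1 y) := by
  rw [capacity, sum_zmod_two, ← Finset.sum_add_distrib]
  rfl

theorem mul_logb_div_eq {a s : ℝ} (h : s = 0 → a = 0) :
    a * Real.logb 2 (a / s) * Real.log 2 = -Real.negMulLog a - a * Real.log s := by
  have h2 : Real.log 2 ≠ 0 := (Real.log_pos one_lt_two).ne'
  by_cases ha : a = 0
  · simp [ha]
  · rw [Real.logb, Real.log_div ha fun hs => ha (h hs), Real.negMulLog]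
    field_simp

theorem letterInfo_mul_log_two {a b : ℝ} (ha : 0 ≤ a) (hb : 0 ≤ b) :
    letterInfo a b * Real.log 2 =
      Real.negMulLog ((1 / 2) * (a + b)) - (Real.negMulLog a + Real.negMulLog b) / 2 := by
  have h₁ := mul_logb_div_eq (a := a) (s := (1 / 2) * (a + b)) fun h => by linarith
  have h₂ := mul_logb_div_eq (a := b) (s := (1 / 2) * (a + b)) fun h => by linarith
  have h₃ : Real.negMulLog ((1 / 2) * (a + b)) =
      -((1 / 2) * (a + b)) * Real.log ((1 / 2) * (a + b)) := rfl
  rw [letterInfo, h₃]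
  linear_combination (1 / 2) * h₁ + (1 / 2) * h₂

theorem letterInfo_comm (a b : ℝ) : letterInfo a b = letterInfo b a := by
  rw [letterInfo, letterInfo, add_comm b a, add_comm]

/-- A letter carries its probability times one minus the binary entropy of its posterior. -/
theorem letterInfo_mul_log_two_eq_binEntropy {a b : ℝ} (ha : 0 ≤ a) (hb : 0 ≤ b) :
    letterInfo a b * Real.log 2 =
      (a + b) / 2 * (Real.log 2 - Real.binEntropy (a / (a + b))) := by
  rcases (add_nonneg ha hb).eq_or_lt with h | h
  · obtain rfl : a = 0 := by linarith
    obtain rfl : b = 0 := by linarith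
    simp [letterInfo]
  · have hne := h.ne'
    have key : ∀ x : ℝ, Real.negMulLog x =
        x / (a + b) * Real.negMulLog (a + b) + (a + b) * Real.negMulLog (x / (a + b)) := by
      intro x
      rw [← Real.negMulLog_mul, mul_div_cancel₀ x hne]
    have hb' : 1 - a / (a + b) = b / (a + b) := by field_simp; ring
    have hhalf : Real.negMulLog (1 / 2) = Real.log 2 / 2 := by
      rw [Real.negMulLog, one_div, Real.log_inv]; ring
    rw [letterInfo_mul_log_two ha hb, Real.binEntropy_eq_negMulLog_add_negMulLog_one_sub, hb',
      Real.negMulLog_mul, hhalf, key a, key b]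
    field_simp
    ring

/-- Mixing the two likelihoods with a symmetric pair contracts the information linearly. -/
theorem letterInfo_mix_le {a b c d : ℝ} (ha : 0 ≤ a) (hb : 0 ≤ b) (hd : 0 ≤ d) (hdc : d ≤ c) :
    letterInfo ((1 / 2) * (a * c + b * d)) ((1 / 2) * (b * c + a * d)) ≤
      letterInfo a b * ((c - d) / 2) := by
  have hl : 0 < Real.log 2 := Real.log_pos one_lt_two
  have hc : 0 ≤ c := hd.trans hdc
  refine le_of_mul_le_mul_right ?_ hl
  have e : letterInfo a b * ((c - d) / 2) * Real.log 2 =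
      (letterInfo a b * Real.log 2) * ((c - d) / 2) := by ring
  rw [e, letterInfo_mul_log_two_eq_binEntropy ha hb,
    letterInfo_mul_log_two_eq_binEntropy (by positivity) (by positivity)]
  rcases (add_nonneg ha hb).eq_or_lt with h | h
  · obtain rfl : a = 0 := by linarith
    obtain rfl : b = 0 := by linarith
    simp
  rcases (add_nonneg hc hd).eq_or_lt with h' | h'
  · obtain rfl : c = 0 := by linarith
    obtain rfl : d = 0 := by linarith
    simp
  have hp₀ : a / (a + b) ∈ Set.Icc (0 : ℝ) 1 :=
    ⟨by positivity, div_le_one_of_le₀ (by linarith) h.le⟩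
  have hp₁ : (2⁻¹ : ℝ) ∈ Set.Icc (0 : ℝ) 1 := ⟨by norm_num, by norm_num⟩
  have hw₀ : 0 ≤ (c - d) / (c + d) := div_nonneg (by linarith) h'.le
  have hw₁ : 0 ≤ 2 * d / (c + d) := by positivity
  have hw : (c - d) / (c + d) + 2 * d / (c + d) = 1 := by
    field_simp
    ring
  have hconc := Real.strictConcave_binEntropy.concaveOn.2 hp₀ hp₁ hw₀ hw₁ hw
  simp only [smul_eq_mul, Real.binEntropy_two_inv] at hconc
  have hp : (c - d) / (c + d) * (a / (a + b)) + 2 * d / (c + d) * 2⁻¹ =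
      (1 / 2) * (a * c + b * d) /
        ((1 / 2) * (a * c + b * d) + (1 / 2) * (b * c + a * d)) := by
    have : (1 / 2) * (a * c + b * d) + (1 / 2) * (b * c + a * d) =
      (1 / 2) * ((a + b) * (c + d)) := by ring
    rw [this]
    field_simp
    ring
  rw [hp] at hconc
  have hmul := mul_le_mul_of_nonneg_left hconc (by positivity : 0 ≤ (a + b) * (c + d) / 4)
  have e₂ : (a + b) * (c + d) / 4 * ((c - d) / (c + d) * Real.binEntropy (a / (a + b)) +
      2 * d / (c + d) * Real.log 2) =
      (a + b) / 4 * ((c - d) * Real.binEntropy (a / (a + b)) + 2 * d * Real.log 2) := by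
    field_simp
  rw [e₂] at hmul
  linarith

theorem letterInfo_minus_le {a b c d : ℝ} (ha : 0 ≤ a) (hb : 0 ≤ b) (hc : 0 ≤ c) (hd : 0 ≤ d) :
    letterInfo ((1 / 2) * (a * c + b * d)) ((1 / 2) * (b * c + a * d)) ≤
      letterInfo a b * (|c - d| / 2) := by
  rcases le_total d c with h | h
  · rw [abs_of_nonneg (by linarith)]
    exact letterInfo_mix_le ha hb hd h
  · rw [abs_of_nonpos (by linarith), neg_sub, letterInfo_comm a b, add_comm (a * c),
      add_comm (b * c)]
    exact letterInfo_mix_le hb ha hc h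

/-- The chain rule of the polar transform, letter by letter. -/
theorem letterInfo_chain {a b c d : ℝ} (ha : 0 ≤ a) (hb : 0 ≤ b) (hc : 0 ≤ c) (hd : 0 ≤ d) :
    letterInfo ((1 / 2) * (a * c + b * d)) ((1 / 2) * (b * c + a * d)) +
        (letterInfo ((1 / 2) * a * c) ((1 / 2) * b * d) +
          letterInfo ((1 / 2) * b * c) ((1 / 2) * a * d)) =
      letterInfo a b * ((c + d) / 2) + (a + b) / 2 * letterInfo c d := by
  have hl : Real.log 2 ≠ 0 := (Real.log_pos one_lt_two).ne'
  have hhalf : Real.negMulLog (1 / 2) = Real.log 2 / 2 := by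
    rw [Real.negMulLog, one_div, Real.log_inv]; ring
  have hsum : (1 / 2) * ((1 / 2) * (a * c + b * d) + (1 / 2) * (b * c + a * d)) =
      ((1 / 2) * (a + b)) * ((1 / 2) * (c + d)) := by ring
  have h₀ := letterInfo_mul_log_two (a := (1 / 2) * (a * c + b * d))
    (b := (1 / 2) * (b * c + a * d)) (by positivity) (by positivity)
  have h₁ := letterInfo_mul_log_two (a := (1 / 2) * a * c)
    (b := (1 / 2) * b * d) (by positivity) (by positivity)
  have h₂ := letterInfo_mul_log_two (a := (1 / 2) * b * c)
    (b := (1 / 2) * a * d) (by positivity) (by positivity)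
  have h₃ := letterInfo_mul_log_two ha hb
  have h₄ := letterInfo_mul_log_two hc hd
  have e₁ : (1 / 2) * a * c + (1 / 2) * b * d = (1 / 2) * (a * c + b * d) := by ring
  have e₂ : (1 / 2) * b * c + (1 / 2) * a * d = (1 / 2) * (b * c + a * d) := by ring
  rw [hsum] at h₀
  rw [e₁] at h₁
  rw [e₂] at h₂
  simp only [Real.negMulLog_mul, hhalf] at h₀ h₁ h₂ h₃ h₄
  refine mul_right_cancel₀ hl ?_
  linear_combination h₀ + h₁ + h₂ - (c + d) / 2 * h₃ - (a + b) / 2 * h₄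

theorem capacity_polarMinus [Fintype Y] (W : ZMod 2 → Y → ℝ) :
    capacity (polarMinus W W) = ∑ y₁, ∑ y₂,
      letterInfo ((1 / 2) * (W 0 y₁ * W 0 y₂ + W 1 y₁ * W 1 y₂))
        ((1 / 2) * (W 1 y₁ * W 0 y₂ + W 0 y₁ * W 1 y₂)) := by
  have h : (1 + 1 : ZMod 2) = 0 := rfl
  simp only [capacity_eq_sum_letterInfo, Fintype.sum_prod_type, polarMinus, sum_zmod_two,
    zero_add, add_zero, h]

theorem capacity_polarPlus [Fintype Y] (W : ZMod 2 → Y → ℝ) :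
    capacity (polarPlus W W) = ∑ y₁, ∑ y₂,
      (letterInfo ((1 / 2) * W 0 y₁ * W 0 y₂) ((1 / 2) * W 1 y₁ * W 1 y₂) +
        letterInfo ((1 / 2) * W 1 y₁ * W 0 y₂) ((1 / 2) * W 0 y₁ * W 1 y₂)) := by
  have h : (1 + 1 : ZMod 2) = 0 := rfl
  simp only [capacity_eq_sum_letterInfo, Fintype.sum_prod_type, polarPlus, sum_zmod_two,
    zero_add, add_zero, h]

theorem IsChannel.sum_half_add [Fintype Y] {W : ZMod 2 → Y → ℝ} (hW : IsChannel W) :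
    ∑ y, (W 0 y + W 1 y) / 2 = 1 := by
  rw [← Finset.sum_div, Finset.sum_add_distrib, hW.2, hW.2]
  norm_num

/-- The polar transform preserves the total symmetric capacity. -/
theorem IsChannel.capacity_polarMinus_add_polarPlus [Fintype Y] {W : ZMod 2 → Y → ℝ}
    (hW : IsChannel W) :
    capacity (polarMinus W W) + capacity (polarPlus W W) = 2 * capacity W := by
  simp only [capacity_polarMinus, capacity_polarPlus, ← Finset.sum_add_distrib]
  simp only [letterInfo_chain (hW.1 _ _) (hW.1 _ _) (hW.1 _ _) (hW.1 _ _)]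
  simp only [Finset.sum_add_distrib, ← Finset.mul_sum, ← Finset.sum_mul, hW.sum_half_add,
    ← capacity_eq_sum_letterInfo]
  ring

theorem IsChannel.capacity_polarMinus_le [Fintype Y] {W : ZMod 2 → Y → ℝ} (hW : IsChannel W) :
    capacity (polarMinus W W) ≤ capacity W * ∑ y, |W 0 y - W 1 y| / 2 := by
  rw [capacity_polarMinus, capacity_eq_sum_letterInfo, Finset.sum_mul_sum]
  exact Finset.sum_le_sum fun y₁ _ => Finset.sum_le_sum fun y₂ _ =>
    letterInfo_minus_le (hW.1 _ _) (hW.1 _ _) (hW.1 _ _) (hW.1 _ _)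

/-- The equivocation is at most the binary entropy of the probability of correct
maximum-likelihood decision. -/
theorem IsChannel.one_sub_capacity_le [Fintype Y] {W : ZMod 2 → Y → ℝ} (hW : IsChannel W) :
    (1 - capacity W) * Real.log 2 ≤ Real.binEntropy (∑ y, max (W 0 y) (W 1 y) / 2) := by
  have hmax : ∀ y, max (W 0 y) (W 1 y) ≤ W 0 y + W 1 y := fun y =>
    max_le (by linarith [hW.1 1 y]) (by linarith [hW.1 0 y])
  have hs : ∀ y, 0 ≤ W 0 y + W 1 y := fun y => add_nonneg (hW.1 0 y) (hW.1 1 y)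
  have hJ := Real.strictConcave_binEntropy.concaveOn.le_map_sum (t := Finset.univ)
    (w := fun y => (W 0 y + W 1 y) / 2)
    (p := fun y => max (W 0 y) (W 1 y) / (W 0 y + W 1 y))
    (fun y _ => div_nonneg (hs y) two_pos.le) hW.sum_half_add
    (fun y _ => ⟨div_nonneg (le_max_of_le_left (hW.1 0 y)) (hs y),
      div_le_one_of_le₀ (hmax y) (hs y)⟩)
  simp only [smul_eq_mul] at hJ
  have hp : ∀ y, (W 0 y + W 1 y) / 2 * (max (W 0 y) (W 1 y) / (W 0 y + W 1 y)) =
      max (W 0 y) (W 1 y) / 2 := by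
    intro y
    rcases (hs y).eq_or_lt with h | h
    · have h0 : W 0 y = 0 := by linarith [hW.1 0 y, hW.1 1 y]
      have h1 : W 1 y = 0 := by linarith [hW.1 0 y, hW.1 1 y]
      simp [h0, h1]
    · field_simp
  have hi : ∀ y, (W 0 y + W 1 y) / 2 *
      Real.binEntropy (max (W 0 y) (W 1 y) / (W 0 y + W 1 y)) =
      (W 0 y + W 1 y) / 2 * Real.log 2 - letterInfo (W 0 y) (W 1 y) * Real.log 2 := by
    intro y
    rcases le_total (W 1 y) (W 0 y) with h | h
    · rw [max_eq_left h, letterInfo_mul_log_two_eq_binEntropy (hW.1 0 y) (hW.1 1 y)]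
      ring
    · rw [max_eq_right h, letterInfo_comm,
        letterInfo_mul_log_two_eq_binEntropy (hW.1 1 y) (hW.1 0 y), add_comm (W 1 y)]
      ring
  simp only [hp, hi, Finset.sum_sub_distrib, ← Finset.sum_mul, hW.sum_half_add,
    ← capacity_eq_sum_letterInfo] at hJ
  linarith

theorem IsChannel.sum_abs_sub [Fintype Y] {W : ZMod 2 → Y → ℝ} (hW : IsChannel W) :
    ∑ y, |W 0 y - W 1 y| / 2 = 2 * ∑ y, max (W 0 y) (W 1 y) / 2 - 1 := by
  rw [← hW.sum_half_add, Finset.mul_sum, ← Finset.sum_sub_distrib]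
  refine Finset.sum_congr rfl fun y _ => ?_
  rcases le_total (W 1 y) (W 0 y) with h | h
  · rw [max_eq_left h, abs_of_nonneg (sub_nonneg.2 h)]
    ring
  · rw [max_eq_right h, abs_of_nonpos (sub_nonpos.2 h)]
    ring

theorem IsChannel.sum_max_le_one [Fintype Y] {W : ZMod 2 → Y → ℝ} (hW : IsChannel W) :
    ∑ y, max (W 0 y) (W 1 y) / 2 ≤ 1 := by
  rw [← hW.sum_half_add]
  refine Finset.sum_le_sum fun y _ => ?_
  have := max_le (le_add_of_nonneg_right (hW.1 1 y)) (le_add_of_nonneg_left (hW.1 0 y))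
  linarith

end Channels

/-- for all 0 < a < b < 1 there is a uniform κ > 0 such that
every BMSC W with a ≤ I(W) ≤ b satisfies I(W⁺) − I(W⁻) ≥ κ. -/
theorem polar_gap_uniform (a b : ℝ) (ha : 0 < a) (hab : a < b) (hb : b < 1) :
    ∃ κ > (0 : ℝ), ∀ (Y : Type) (_ : Fintype Y) (W : ZMod 2 → Y → ℝ),
      IsBMSC W → a ≤ capacity W → capacity W ≤ b →
      κ ≤ capacity (polarPlus W W) - capacity (polarMinus W W) := by
  have hl : 0 < Real.log 2 := Real.log_pos one_lt_two
  have hev : ∀ᶠ p in nhds (1 : ℝ), Real.binEntropy p < (1 - b) * Real.log 2 := by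
    refine Real.binEntropy_continuous.continuousAt.eventually_lt continuousAt_const ?_
    rw [Real.binEntropy_one]
    exact mul_pos (by linarith) hl
  obtain ⟨δ, hδ, hball⟩ := Metric.eventually_nhds_iff.1 hev
  refine ⟨4 * a * δ, by positivity, fun Y _ W hW haW hbW => ?_⟩
  have hC := hW.1
  have hgap : ∑ y, max (W 0 y) (W 1 y) / 2 ≤ 1 - δ := by
    by_contra! hlt
    have h₁ := hball (y := ∑ y, max (W 0 y) (W 1 y) / 2) (by
      rw [Real.dist_eq, abs_lt]
      constructor <;> linarith [hC.sum_max_le_one])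
    have h₂ := mul_le_mul_of_nonneg_right (sub_le_sub_left hbW 1) hl.le
    linarith [hC.one_sub_capacity_le]
  have hsum := hC.capacity_polarMinus_add_polarPlus
  have hminus := hC.capacity_polarMinus_le
  rw [hC.sum_abs_sub] at hminus
  have h₁ : a * δ ≤ capacity W * (1 - ∑ y, max (W 0 y) (W 1 y) / 2) :=
    mul_le_mul haW (by linarith) hδ.le (by linarith)
  linarith
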